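/- arXiv:2107.05011 — 3 statements merged into one kernel-verified Lean document; each statement's English description precedes it below -/
import Mathlib

section
/- On the real inner product space of real symmetric n×n matrices equipped with the Frobenius inner product ⟨X,Y⟩ = trace(XᵀY), the function f(U) = (1/2)‖Π_+(U)‖_F² is Fréchet differentiable at every symmetric matrix U, with gradient ∇f(U) = Π_+(U); that is, f(U + H) − f(U) − ⟨Π_+(U), H⟩ = o(‖H‖_F) as the symmetric perturbation H → 0. -/
open Matrix Asymptotics

/-- The positive part `Π₊(M) = Σᵢ max(0, λᵢ) pᵢ pᵢᵀ` of a real symmetric matrix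
(junk value `0` for non-symmetric matrices). -/
noncomputable def posPartT {n : Type*} [Fintype n] [DecidableEq n] (M : Matrix n n ℝ) :
    Matrix n n ℝ :=
  if h : M.IsHermitian then
    (h.eigenvectorUnitary : Matrix n n ℝ) *
      Matrix.diagonal (fun i => max 0 (h.eigenvalues i)) *
      star (h.eigenvectorUnitary : Matrix n n ℝ)
  else 0

/-- Frobenius norm. -/
noncomputable def frobNorm {n : Type*} [Fintype n] (M : Matrix n n ℝ) : ℝ :=
  Real.sqrt (∑ i, ∑ j, (M i j) ^ 2)

/-- The Frobenius inner product `⟨X, Y⟩ = trace(Xᵀ Y)`. -/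
noncomputable def frobInner {n : Type*} [Fintype n] (X Y : Matrix n n ℝ) : ℝ :=
  Matrix.trace (Xᵀ * Y)

lemma aux_frobNorm_sq {n : ℕ} (M : Matrix (Fin n) (Fin n) ℝ) :
    frobNorm M ^ 2 = frobInner M M := by
  unfold frobNorm frobInner
  have h0 : 0 ≤ ∑ i, ∑ j, (M i j) ^ 2 :=
    Finset.sum_nonneg fun i _ => Finset.sum_nonneg fun j _ => sq_nonneg _
  refine (Real.sq_sqrt h0).trans ?_
  rw [Finset.sum_comm]
  simp [Matrix.trace, Matrix.mul_apply, sq]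

lemma aux_trace {n : ℕ} {A B : Matrix (Fin n) (Fin n) ℝ} (hA : A.PosSemidef)
    (hB : B.PosSemidef) : 0 ≤ frobInner A B := by
  have hs := hA.1.spectral_theorem
  set W : Matrix (Fin n) (Fin n) ℝ := (hA.1.eigenvectorUnitary : Matrix (Fin n) (Fin n) ℝ) with hW
  have hAe : A = W * Matrix.diagonal hA.1.eigenvalues * Wᴴ := by
    conv_lhs => rw [hs]
    simp [Unitary.conjStarAlgAut_apply, hW, Matrix.star_eq_conjTranspose]
  have hAt : Aᵀ = A := by simpa [Matrix.IsHermitian] using hA.1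
  unfold frobInner
  rw [hAt, hAe, Matrix.mul_assoc, Matrix.mul_assoc, Matrix.trace_mul_comm, Matrix.mul_assoc]
  have h2 := hB.conjTranspose_mul_mul_same W
  rw [Matrix.trace]
  refine Finset.sum_nonneg fun i _ => ?_
  rw [Matrix.diag_apply, Matrix.diagonal_mul]
  exact mul_nonneg (hA.eigenvalues_nonneg i) h2.diag_nonneg

lemma aux_decomp {n : ℕ} (M : Matrix (Fin n) (Fin n) ℝ) (h : M.IsHermitian) :
    ∃ N : Matrix (Fin n) (Fin n) ℝ, (posPartT M).PosSemidef ∧ N.PosSemidef ∧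
      M = posPartT M - N ∧ frobInner (posPartT M) N = 0 := by
  set W : Matrix (Fin n) (Fin n) ℝ := (h.eigenvectorUnitary : Matrix (Fin n) (Fin n) ℝ) with hW
  have hWW : Wᴴ * W = 1 := by
    rw [← Matrix.star_eq_conjTranspose]
    exact Unitary.coe_star_mul_self h.eigenvectorUnitary
  have hMe : M = W * Matrix.diagonal h.eigenvalues * Wᴴ := by
    conv_lhs => rw [h.spectral_theorem]
    simp [Unitary.conjStarAlgAut_apply, hW, Matrix.star_eq_conjTranspose]
  have hP : posPartT M = W * Matrix.diagonal (fun i => max 0 (h.eigenvalues i)) * Wᴴ := by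
    simp only [posPartT, h, dite_true, hW, Matrix.star_eq_conjTranspose]
  have hPp : (posPartT M).PosSemidef := by
    rw [hP]
    exact (Matrix.PosSemidef.diagonal (fun i => le_max_left _ _)).mul_mul_conjTranspose_same W
  refine ⟨W * Matrix.diagonal (fun i => max 0 (- h.eigenvalues i)) * Wᴴ, hPp,
    (Matrix.PosSemidef.diagonal (fun i => le_max_left _ _)).mul_mul_conjTranspose_same W, ?_, ?_⟩
  · rw [hP]
    conv_lhs => rw [hMe]
    rw [← Matrix.sub_mul, ← Matrix.mul_sub, Matrix.diagonal_sub]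
    congr 3
    funext i
    rcases le_total 0 (h.eigenvalues i) with h0 | h0 <;> simp [h0]
  · have hAt : (posPartT M)ᵀ = posPartT M := by simpa [Matrix.IsHermitian] using hPp.1
    unfold frobInner
    rw [hAt, hP]
    have : W * Matrix.diagonal (fun i => max 0 (h.eigenvalues i)) * Wᴴ *
        (W * Matrix.diagonal (fun i => max 0 (- h.eigenvalues i)) * Wᴴ) =
        W * (Matrix.diagonal (fun i => max 0 (h.eigenvalues i)) * (Wᴴ * W) *
          Matrix.diagonal (fun i => max 0 (- h.eigenvalues i))) * Wᴴ := by
      simp only [Matrix.mul_assoc]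
    rw [this, hWW, Matrix.mul_one, Matrix.diagonal_mul_diagonal]
    have h0 : (fun i => max 0 (h.eigenvalues i) * max 0 (- h.eigenvalues i)) = fun _ => 0 := by
      funext i
      rcases le_total 0 (h.eigenvalues i) with h0 | h0 <;> simp [h0]
    rw [h0]
    simp

lemma aux_comm {n : ℕ} (A B : Matrix (Fin n) (Fin n) ℝ) : frobInner A B = frobInner B A := by
  unfold frobInner
  rw [← Matrix.trace_transpose]
  simp

lemma aux_sub_left {n : ℕ} (A B C : Matrix (Fin n) (Fin n) ℝ) :
    frobInner (A - B) C = frobInner A C - frobInner B C := by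
  simp [frobInner, Matrix.sub_mul]

lemma aux_sub_right {n : ℕ} (A B C : Matrix (Fin n) (Fin n) ℝ) :
    frobInner A (B - C) = frobInner A B - frobInner A C := by
  simp [frobInner, Matrix.mul_sub]

lemma aux_bound {n : ℕ} (U H : Matrix (Fin n) (Fin n) ℝ) (hU : U.IsHermitian)
    (hH : H.IsHermitian) :
    |(1 / 2 : ℝ) * (frobNorm (posPartT (U + H))) ^ 2
          - (1 / 2 : ℝ) * (frobNorm (posPartT U)) ^ 2
          - frobInner (posPartT U) H| ≤ frobNorm H ^ 2 := by
  obtain ⟨N, hP, hN, hUe, hPN⟩ := aux_decomp U hU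
  obtain ⟨M, hQ, hM, hVe, hQM⟩ := aux_decomp (U + H) (hU.add hH)
  set P := posPartT U
  set Q := posPartT (U + H)
  have hHe : H = (Q - M) - (P - N) := by rw [← hVe, ← hUe]; simp
  have h1 := aux_trace hP hM
  have h2 := aux_trace hQ hN
  have h3 : 0 ≤ frobInner (Q - P) (Q - P) := by rw [← aux_frobNorm_sq]; positivity
  have h4 : 0 ≤ frobInner (M - N) (M - N) := by rw [← aux_frobNorm_sq]; positivity
  rw [hHe]
  simp only [aux_frobNorm_sq, aux_sub_left, aux_sub_right] at *
  rw [aux_comm Q P] at *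
  rw [aux_comm M N, aux_comm M P, aux_comm M Q, aux_comm N P, aux_comm N Q] at *
  rw [abs_le]
  constructor <;> linarith

/-- On symmetric matrices with the Frobenius inner product, the function
`f(U) = (1/2)‖Π₊(U)‖_F²` is (Fréchet) differentiable at every symmetric `U` with gradient
`Π₊(U)`: one has `f(U + H) − f(U) − ⟨Π₊(U), H⟩ = o(‖H‖_F)` as the symmetric perturbation
`H → 0`. -/
theorem stmt_4 (n : ℕ) (U : Matrix (Fin n) (Fin n) ℝ) (hU : U.IsHermitian) :
    (fun H : Matrix (Fin n) (Fin n) ℝ =>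
        (1 / 2 : ℝ) * (frobNorm (posPartT (U + H))) ^ 2
          - (1 / 2 : ℝ) * (frobNorm (posPartT U)) ^ 2
          - frobInner (posPartT U) H)
      =o[nhdsWithin 0 {H : Matrix (Fin n) (Fin n) ℝ | H.IsHermitian}]
        (fun H => frobNorm H) := by
  have hc : Continuous (fun H : Matrix (Fin n) (Fin n) ℝ => frobNorm H) := by
    unfold frobNorm
    fun_prop
  have ht : Filter.Tendsto (fun H : Matrix (Fin n) (Fin n) ℝ => frobNorm H)
      (nhdsWithin 0 {H : Matrix (Fin n) (Fin n) ℝ | H.IsHermitian}) (nhds 0) := by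
    have := (hc.tendsto 0).mono_left
      (nhdsWithin_le_nhds (s := {H : Matrix (Fin n) (Fin n) ℝ | H.IsHermitian}))
    simpa [frobNorm] using this
  rw [Asymptotics.isLittleO_iff]
  intro c hcp
  filter_upwards [ht.eventually (gt_mem_nhds hcp), self_mem_nhdsWithin] with H h1 h2
  have h0 : 0 ≤ frobNorm H := Real.sqrt_nonneg _
  rw [Real.norm_eq_abs, Real.norm_eq_abs, abs_of_nonneg h0]
  refine (aux_bound U H hU h2).trans ?_
  rw [sq]
  exact mul_le_mul_of_nonneg_right h1.le h0
end

section
/- Let A be a real symmetric (D+1)×(D+1) matrix, γ > 0, and for u ∈ ℝ^{D+1} define C(u) = −A − diag(u) and the dual function d_γ(u) = −uᵀ𝟙 − (γ/2)‖Π_+(C(u))‖_F². Then d_γ is differentiable on ℝ^{D+1} and its gradient is ∇_u d_γ(u) = −𝟙 + γ · diag(Π_+(C(u))), i.e., for each i ∈ {1,…,D+1}, ∂d_γ/∂u_i (u) = −1 + γ (Π_+(C(u)))_{ii}. -/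
open Matrix

/-- trace of product with a conjugated nonnegative diagonal. -/
lemma trace_conj_nonneg {n : Type*} [Fintype n] [DecidableEq n] (U N : Matrix n n ℝ)
    (a : n → ℝ) (ha : ∀ i, 0 ≤ a i) (hN : N.PosSemidef) :
    0 ≤ ((U * Matrix.diagonal a * star U) * N).trace := by
  have h1 : ((U * Matrix.diagonal a * star U) * N).trace
      = (Matrix.diagonal a * (star U * N * U)).trace := by
    rw [Matrix.mul_assoc, Matrix.mul_assoc, Matrix.trace_mul_comm]
    simp only [Matrix.mul_assoc]
  rw [h1, Matrix.trace]
  refine Finset.sum_nonneg fun i _ => ?_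
  rw [Matrix.diag_apply, Matrix.diagonal_mul]
  refine mul_nonneg (ha i) ?_
  have := hN.conjTranspose_mul_mul_same U
  exact this.diag_nonneg

/-- Basic facts on the positive part. -/
lemma posPartT_facts {n : Type*} [Fintype n] [DecidableEq n] (M : Matrix n n ℝ)
    (h : M.IsHermitian) :
    (posPartT M).IsHermitian ∧ (posPartT M - M).PosSemidef ∧
    (posPartT M * (posPartT M - M)).trace = 0 ∧
    ∀ N : Matrix n n ℝ, N.PosSemidef → 0 ≤ (posPartT M * N).trace := by
  set U : Matrix n n ℝ := (h.eigenvectorUnitary : Matrix n n ℝ) with hU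
  have hUU : star U * U = 1 := Unitary.coe_star_mul_self _
  have hP : posPartT M = U * Matrix.diagonal (fun i => max 0 (h.eigenvalues i)) * star U := by
    rw [posPartT, dif_pos h]
  have hM : M = U * Matrix.diagonal (fun i => h.eigenvalues i) * star U := by
    have := h.spectral_theorem
    rw [Unitary.conjStarAlgAut_apply] at this
    exact this
  have hN : posPartT M - M
      = U * Matrix.diagonal (fun i => max 0 (h.eigenvalues i) - h.eigenvalues i) * star U := by
    refine (congrArg₂ (fun a b => a - b) hP hM).trans ?_
    beta_reduce
    rw [← Matrix.sub_mul, ← Matrix.mul_sub, Matrix.diagonal_sub]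
  refine ⟨?_, ?_, ?_, ?_⟩
  · rw [hP]
    exact Matrix.isHermitian_mul_mul_conjTranspose U (Matrix.isHermitian_diagonal _)
  · rw [hN]
    refine Matrix.PosSemidef.mul_mul_conjTranspose_same (B := U) (Matrix.PosSemidef.diagonal ?_)
    intro i
    simp
  · rw [hN, hP]
    have : U * Matrix.diagonal (fun i => max 0 (h.eigenvalues i)) * star U *
        (U * Matrix.diagonal (fun i => max 0 (h.eigenvalues i) - h.eigenvalues i) * star U)
        = U * (Matrix.diagonal (fun i => max 0 (h.eigenvalues i)) * (star U *
        U) * Matrix.diagonal (fun i => max 0 (h.eigenvalues i) - h.eigenvalues i)) * star U := by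
      simp only [Matrix.mul_assoc]
    rw [this, hUU, Matrix.mul_one, Matrix.diagonal_mul_diagonal]
    have h0 : (fun i => max 0 (h.eigenvalues i) * (max 0 (h.eigenvalues i) - h.eigenvalues i))
        = fun _ => 0 := by
      funext i
      rcases le_total 0 (h.eigenvalues i) with h' | h'
      · rw [max_eq_right h']; ring
      · rw [max_eq_left h']; ring
    rw [h0]
    simp
  · intro N hN
    rw [hP]
    exact trace_conj_nonneg U N _ (fun i => le_max_left _ _) hN

lemma frobNorm_sq {n : Type*} [Fintype n] (M : Matrix n n ℝ) (h : M.IsHermitian) :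
    frobNorm M ^ 2 = (M * M).trace := by
  rw [frobNorm, Real.sq_sqrt (by positivity), Matrix.trace]
  refine Finset.sum_congr rfl fun i _ => ?_
  rw [Matrix.diag_apply, Matrix.mul_apply]
  refine Finset.sum_congr rfl fun j _ => ?_
  have := h.apply i j
  simp only [star_trivial] at this
  rw [this, sq]

lemma trace_self_nonneg {n : Type*} [Fintype n] (M : Matrix n n ℝ) (h : M.IsHermitian) :
    0 ≤ (M * M).trace := by
  rw [← frobNorm_sq M h]; positivity

/-- Two sided quadratic bound. -/
lemma quad_bound {n : Type*} [Fintype n] [DecidableEq n] (X Y : Matrix n n ℝ)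
    (hX : X.IsHermitian) (hY : Y.IsHermitian) :
    0 ≤ frobNorm (posPartT Y) ^ 2 - frobNorm (posPartT X) ^ 2
        - 2 * (posPartT X * (Y - X)).trace ∧
    frobNorm (posPartT Y) ^ 2 - frobNorm (posPartT X) ^ 2
        - 2 * (posPartT X * (Y - X)).trace ≤ ((Y - X) * (Y - X)).trace := by
  obtain ⟨hP, hN, hPN, hPp⟩ := posPartT_facts X hX
  obtain ⟨hQ, hL, hQL, hQp⟩ := posPartT_facts Y hY
  rw [frobNorm_sq _ hP, frobNorm_sq _ hQ]
  have e1 := hPp _ hL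
  have e2 := hQp _ hN
  have e3 := trace_self_nonneg _ (hQ.sub hP)
  have e4 := trace_self_nonneg _ (hL.isHermitian.sub hN.isHermitian)
  have c1 := Matrix.trace_mul_comm (posPartT X) (posPartT Y)
  have c2 := Matrix.trace_mul_comm (posPartT X) X
  have c3 := Matrix.trace_mul_comm (posPartT X) Y
  have c4 := Matrix.trace_mul_comm (posPartT Y) X
  have c5 := Matrix.trace_mul_comm (posPartT Y) Y
  have c6 := Matrix.trace_mul_comm X Y
  simp only [Matrix.mul_sub, Matrix.sub_mul, Matrix.trace_sub] at *
  constructor <;> linarith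

/-- With `C(u) = −A − diag(u)` and
`d_γ(u) = −uᵀ𝟙 − (γ/2)‖Π₊(C(u))‖_F²`, the dual function `d_γ` is differentiable on
`ℝ^{D+1}` with gradient `∇d_γ(u) = −𝟙 + γ·diag(Π₊(C(u)))`, i.e. its (Fréchet) derivative
at `u` is the linear functional `h ↦ Σᵢ (−1 + γ(Π₊(C(u)))ᵢᵢ) hᵢ`. -/
theorem stmt_5 (D : ℕ) (A : Matrix (Fin (D + 1)) (Fin (D + 1)) ℝ) (hA : A.IsHermitian)
    (γ : ℝ) (hγ : 0 < γ) (u : Fin (D + 1) → ℝ) :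
    HasFDerivAt
      (fun w : Fin (D + 1) → ℝ =>
        -(w ⬝ᵥ (fun _ => (1 : ℝ)))
          - γ / 2 * (frobNorm (posPartT (-A - Matrix.diagonal w))) ^ 2)
      (∑ i : Fin (D + 1),
        (-1 + γ * (posPartT (-A - Matrix.diagonal u)) i i) •
          (ContinuousLinearMap.proj i : (Fin (D + 1) → ℝ) →L[ℝ] ℝ))
      u := by
  have key : ∀ w : Fin (D + 1) → ℝ,
      |frobNorm (posPartT (-A - Matrix.diagonal w)) ^ 2
        - frobNorm (posPartT (-A - Matrix.diagonal u)) ^ 2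
        + 2 * ∑ i, (posPartT (-A - Matrix.diagonal u)) i i * (w i - u i)|
        ≤ (D + 1) * ‖w - u‖ ^ 2 := by
    intro w
    have hb := quad_bound (-A - Matrix.diagonal u) (-A - Matrix.diagonal w)
      (hA.neg.sub (Matrix.isHermitian_diagonal _)) (hA.neg.sub (Matrix.isHermitian_diagonal _))
    have hd : -A - Matrix.diagonal w - (-A - Matrix.diagonal u)
        = Matrix.diagonal (fun i => u i - w i) := by
      rw [← Matrix.diagonal_sub]; abel
    rw [hd] at hb
    have t1 : (posPartT (-A - Matrix.diagonal u) * Matrix.diagonal (fun i => u i - w i)).trace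
        = - ∑ i, (posPartT (-A - Matrix.diagonal u)) i i * (w i - u i) := by
      rw [Matrix.trace, ← Finset.sum_neg_distrib]
      refine Finset.sum_congr rfl fun i _ => ?_
      rw [Matrix.diag_apply, Matrix.mul_diagonal]; ring
    have t2 : (Matrix.diagonal (fun i => u i - w i) * Matrix.diagonal (fun i => u i - w i)).trace
        ≤ (D + 1) * ‖w - u‖ ^ 2 := by
      rw [Matrix.diagonal_mul_diagonal, Matrix.trace_diagonal]
      calc ∑ i, (u i - w i) * (u i - w i) ≤ ∑ _i : Fin (D + 1), ‖w - u‖ ^ 2 := by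
            refine Finset.sum_le_sum fun i _ => ?_
            have := norm_le_pi_norm (w - u) i
            rw [Pi.sub_apply, Real.norm_eq_abs] at this
            have h2 := pow_le_pow_left₀ (abs_nonneg _) this 2
            rw [sq_abs] at h2
            linarith
        _ = (D + 1) * ‖w - u‖ ^ 2 := by simp
    rw [t1] at hb
    rw [abs_le]
    constructor <;> [skip; linarith [hb.2]]
    have : 0 ≤ ((D : ℝ) + 1) * ‖w - u‖ ^ 2 := by positivity
    linarith [hb.1]
  rw [hasFDerivAt_iff_isLittleO]
  refine Asymptotics.IsBigO.trans_isLittleO (g := fun w => ‖w - u‖ ^ 2) ?_ ?_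
  · refine Asymptotics.IsBigO.of_bound (γ / 2 * (D + 1)) (Filter.Eventually.of_forall fun w => ?_)
    have e : (-(w ⬝ᵥ (fun _ => (1 : ℝ)))
          - γ / 2 * (frobNorm (posPartT (-A - Matrix.diagonal w))) ^ 2)
        - (-(u ⬝ᵥ (fun _ => (1 : ℝ)))
          - γ / 2 * (frobNorm (posPartT (-A - Matrix.diagonal u))) ^ 2)
        - (∑ i : Fin (D + 1), (-1 + γ * (posPartT (-A - Matrix.diagonal u)) i i) •
          (ContinuousLinearMap.proj i : (Fin (D + 1) → ℝ) →L[ℝ] ℝ)) (w - u)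
        = -(γ / 2) * (frobNorm (posPartT (-A - Matrix.diagonal w)) ^ 2
        - frobNorm (posPartT (-A - Matrix.diagonal u)) ^ 2
        + 2 * ∑ i, (posPartT (-A - Matrix.diagonal u)) i i * (w i - u i)) := by
      have e2 : (∑ i : Fin (D + 1), (-1 + γ * (posPartT (-A - Matrix.diagonal u)) i i) •
          (ContinuousLinearMap.proj i : (Fin (D + 1) → ℝ) →L[ℝ] ℝ)) (w - u)
          = - ∑ i, w i + ∑ i, u i
            + γ * ∑ i, (posPartT (-A - Matrix.diagonal u)) i i * (w i - u i) := by
        rw [Finset.mul_sum, ← Finset.sum_neg_distrib, ← Finset.sum_add_distrib,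
          ← Finset.sum_add_distrib, _root_.sum_apply]
        refine Finset.sum_congr rfl fun i _ => ?_
        simp only [_root_.smul_apply, ContinuousLinearMap.proj_apply,
          Pi.sub_apply, smul_eq_mul]
        ring
      rw [e2]
      simp only [dotProduct, mul_one]
      ring
    rw [e, norm_mul, norm_neg, Real.norm_of_nonneg (by positivity : 0 ≤ γ / 2),
      Real.norm_of_nonneg (by positivity : 0 ≤ ‖w - u‖ ^ 2), Real.norm_eq_abs, mul_assoc]
    exact mul_le_mul_of_nonneg_left (key w) (by positivity)
  · exact Asymptotics.isLittleO_pow_sub_sub u (by norm_num)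
end

section
/- Let C be a real symmetric (D+1)×(D+1) matrix and m ≥ 1 with m ≤ D. Let p_1, …, p_m ∈ ℝ^{D+1} be orthonormal vectors, set p_0 = 0 and β_1 = 0, and define recursively for j = 1, …, m: α_j = ⟨C p_j − β_j p_{j−1}, p_j⟩ and β_{j+1} = ‖C p_j − β_j p_{j−1} − α_j p_j‖₂. Define m̄ = trace(C)/(D+1), s² = trace(C²)/(D+1) − m̄² (with s = √(s²) ≥ 0), σ_max,UB = m̄ + s·√D, σ_max,LB = m̄ + s/√D, and the normalized Minkowski ℓ₁-norm σ̂_max,Minkowski = (1/(D+1)) Σ_{ℓ=1}^{D+1} Σ_{j=1}^{D+1} |C(ℓ, j)|. Assume σ_max(C) ≤ σ_max,UB and σ_max,LB ≤ σ̂_max,Minkowski. Then β_{m+1} ≤ 2m ((σ_max,UB − σ_max,LB) + σ̂_max,Minkowski). -/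
open Matrix

/-- The eigenvalues of a real symmetric matrix (Mathlib's enumeration; junk value `0`
for non-symmetric matrices). -/
noncomputable def eigsT {n : Type*} [Fintype n] [DecidableEq n] (M : Matrix n n ℝ) : n → ℝ :=
  if h : M.IsHermitian then h.eigenvalues else 0

/-- Euclidean norm on `ℝⁿ`. -/
noncomputable def eNorm {n : Type*} [Fintype n] (v : n → ℝ) : ℝ :=
  Real.sqrt (∑ i, (v i) ^ 2)

/-- Largest singular value: `σ_max(M) = √(λ_max(MᵀM))`. -/
noncomputable def specNorm {n : Type*} [Fintype n] [DecidableEq n] (M : Matrix n n ℝ) : ℝ :=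
  Real.sqrt (⨆ i, eigsT (Mᵀ * M) i)

/-- `eNorm` is the norm of `EuclideanSpace`. -/
lemma eNorm_eq {n : Type*} [Fintype n] (v : n → ℝ) : eNorm v = ‖WithLp.toLp 2 v‖ := by
  simp [eNorm, EuclideanSpace.norm_eq]

lemma eNorm_sub_le {n : Type*} [Fintype n] (v w : n → ℝ) : eNorm (v - w) ≤ eNorm v + eNorm w := by
  rw [eNorm_eq, eNorm_eq, eNorm_eq, WithLp.toLp_sub]
  exact norm_sub_le _ _

lemma eNorm_smul {n : Type*} [Fintype n] (c : ℝ) (w : n → ℝ) : eNorm (c • w) = |c| * eNorm w := by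
  rw [eNorm_eq, eNorm_eq, WithLp.toLp_smul, norm_smul, Real.norm_eq_abs]

lemma abs_dot_le {n : Type*} [Fintype n] (v w : n → ℝ) : |v ⬝ᵥ w| ≤ eNorm v * eNorm w := by
  rw [eNorm_eq, eNorm_eq]
  have h := abs_real_inner_le_norm (WithLp.toLp 2 w) (WithLp.toLp 2 v)
  rw [EuclideanSpace.inner_toLp_toLp] at h
  simpa [mul_comm] using h

lemma eNorm_one {n : Type*} [Fintype n] (v : n → ℝ) (h : v ⬝ᵥ v = 1) : eNorm v = 1 := by
  unfold eNorm
  rw [show ∑ i, (v i) ^ 2 = 1 by rw [← h]; simp [dotProduct, sq]]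
  simp

lemma dot_le_sup {n : Type*} [Fintype n] [DecidableEq n] (A : Matrix n n ℝ) (hA : A.IsHermitian)
    (v : n → ℝ) (h : v ⬝ᵥ v = 1) : v ⬝ᵥ (A *ᵥ v) ≤ ⨆ i, eigsT A i := by
  have he : eigsT A = hA.eigenvalues := dif_pos hA
  rw [he]
  set b := hA.eigenvectorBasis
  have key : ∀ x y : n → ℝ, x ⬝ᵥ y = ∑ i, (x ⬝ᵥ (b i).ofLp) * ((b i).ofLp ⬝ᵥ y) := by
    intro x y
    have h1 := b.sum_inner_mul_inner (WithLp.toLp 2 x) (WithLp.toLp 2 y)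
    simp only [EuclideanSpace.inner_eq_star_dotProduct, star_trivial] at h1
    rw [dotProduct_comm x y, ← h1]
    refine Finset.sum_congr rfl fun i _ => ?_
    rw [dotProduct_comm x, dotProduct_comm _ y]
  have hT : Aᵀ = A := by rw [← conjTranspose_eq_transpose_of_trivial]; exact hA
  have h2 : ∀ i, (b i).ofLp ⬝ᵥ (A *ᵥ v) = hA.eigenvalues i * (v ⬝ᵥ (b i).ofLp) := by
    intro i
    rw [dotProduct_mulVec, ← mulVec_transpose, hT, hA.mulVec_eigenvectorBasis i, smul_dotProduct,
      dotProduct_comm, smul_eq_mul]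
  rw [key v (A *ᵥ v)]
  calc _ ≤ ∑ i, (⨆ j, hA.eigenvalues j) * ((v ⬝ᵥ (b i).ofLp) * ((b i).ofLp ⬝ᵥ v)) := by
        refine Finset.sum_le_sum fun i _ => ?_
        rw [h2, dotProduct_comm _ v]
        have := le_ciSup (Set.finite_range hA.eigenvalues).bddAbove i
        nlinarith [mul_self_nonneg (v ⬝ᵥ (b i).ofLp)]
    _ = _ := by rw [← Finset.mul_sum, ← key, h, mul_one]

lemma eNorm_mulVec_le {n : Type*} [Fintype n] [DecidableEq n] (C : Matrix n n ℝ)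
    (v : n → ℝ) (h : v ⬝ᵥ v = 1) : eNorm (C *ᵥ v) ≤ specNorm C := by
  unfold specNorm eNorm
  apply Real.sqrt_le_sqrt
  have hA : (Cᵀ * C).IsHermitian := by
    simpa using Matrix.isHermitian_conjTranspose_mul_self C
  refine le_trans (le_of_eq ?_) (dot_le_sup _ hA v h)
  rw [← mulVec_mulVec, dotProduct_mulVec, vecMul_transpose]
  simp [dotProduct, sq]

/-- Lemma 3 of the paper: an a-priori, EVD-free bound on the Lanczos
coefficient. With `m̄ = trace(C)/(D+1)`, `s = √(trace(C²)/(D+1) − m̄²)`,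
`σ_UB = m̄ + s√D`, `σ_LB = m̄ + s/√D`, and the normalized Minkowski ℓ₁-norm
`σ̂ = (1/(D+1)) Σ_ℓ Σ_j |C(ℓ,j)|`; assuming `σ_max(C) ≤ σ_UB` and `σ_LB ≤ σ̂`, the Lanczos
coefficient satisfies `β_{m+1} ≤ 2m((σ_UB − σ_LB) + σ̂)`. -/
theorem stmt_14 (D m : ℕ) (hm : 1 ≤ m) (hmD : m ≤ D)
    (C : Matrix (Fin (D + 1)) (Fin (D + 1)) ℝ) (hC : C.IsHermitian)
    (p : ℕ → Fin (D + 1) → ℝ) (hp0 : p 0 = 0)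
    (horth : ∀ i j, 1 ≤ i → i ≤ m → 1 ≤ j → j ≤ m →
      p i ⬝ᵥ p j = if i = j then (1 : ℝ) else 0)
    (α β : ℕ → ℝ) (hβ1 : β 1 = 0)
    (hα : ∀ j, 1 ≤ j → j ≤ m →
      α j = (C.mulVec (p j) - β j • p (j - 1)) ⬝ᵥ p j)
    (hβ : ∀ j, 1 ≤ j → j ≤ m →
      β (j + 1) = eNorm (C.mulVec (p j) - β j • p (j - 1) - α j • p j))
    (mbar s σUB σLB σMink : ℝ)
    (hmbar : mbar = Matrix.trace C / (D + 1))
    (hs : s = Real.sqrt (Matrix.trace (C * C) / (D + 1) - mbar ^ 2))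
    (hUB : σUB = mbar + s * Real.sqrt D)
    (hLB : σLB = mbar + s / Real.sqrt D)
    (hMink : σMink = (1 / (D + 1 : ℝ)) * ∑ ℓ, ∑ j, |C ℓ j|)
    (hσmax : specNorm C ≤ σUB)
    (hσlb : σLB ≤ σMink) :
    β (m + 1) ≤ 2 * m * ((σUB - σLB) + σMink) := by
  have hone : ∀ j, 1 ≤ j → j ≤ m → p j ⬝ᵥ p j = 1 := by
    intro j h1 h2
    simpa using horth j j h1 h2 h1 h2
  have hind : ∀ k, k ≤ m → 0 ≤ β (k + 1) ∧ β (k + 1) ≤ 2 * k * specNorm C := by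
    intro k
    induction k with
    | zero => intro _; simp [hβ1]
    | succ k ih =>
      intro hk
      obtain ⟨h0, hle⟩ := ih (by omega)
      have e := hβ (k + 1) (by omega) hk
      have a := hα (k + 1) (by omega) hk
      rw [Nat.add_sub_cancel] at e a
      have h1 := hone (k + 1) (by omega) hk
      have hn := eNorm_one _ h1
      have hCp := eNorm_mulVec_le C _ h1
      have hz : p k ⬝ᵥ p (k + 1) = 0 ∧ eNorm (p k) ≤ 1 := by
        rcases Nat.eq_zero_or_pos k with rfl | hpos
        · rw [hp0]; simp [eNorm]
        · refine ⟨?_, (eNorm_one _ (hone k hpos (by omega))).le⟩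
          rw [horth k (k + 1) hpos (by omega) (by omega) hk]; simp
      rw [sub_dotProduct, smul_dotProduct, hz.1, smul_zero, sub_zero] at a
      have ha : |α (k + 1)| ≤ specNorm C := by
        have := abs_dot_le (C *ᵥ p (k + 1)) (p (k + 1))
        rw [a]; rw [hn, mul_one] at this; exact this.trans hCp
      refine ⟨by rw [e]; exact Real.sqrt_nonneg _, ?_⟩
      have t1 := eNorm_sub_le (C *ᵥ p (k + 1) - β (k + 1) • p k) (α (k + 1) • p (k + 1))
      have t2 := eNorm_sub_le (C *ᵥ p (k + 1)) (β (k + 1) • p k)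
      rw [eNorm_smul, hn] at t1
      rw [eNorm_smul, abs_of_nonneg h0] at t2
      have t3 := mul_le_mul_of_nonneg_left hz.2 h0
      rw [e]; push_cast
      linarith
  refine (hind m le_rfl).2.trans ?_
  exact mul_le_mul_of_nonneg_left (by linarith) (by positivity)
end
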